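/- arXiv:1409.6409 — 3 statements merged into one kernel-verified Lean document; each statement's English description precedes it below -/
import Mathlib

section
/- Let X be a symmetric solution of CGDARE(Σ) and write X_U = Uᵀ X U = [[X₁₁, X₁₂], [X₁₂ᵀ, X₂₂]] with X₁₁ ∈ ℝ^{(n−ν)×(n−ν)}. Then X₁₂ = Q₁₂ and X₂₂ = Q₂₂. -/
open Matrix

/-- `Md` satisfies the four Penrose equations for `M`, i.e. it is the
Moore–Penrose pseudoinverse `M†` of `M`. -/
def IsMP {p q : ℕ} (M : Matrix (Fin p) (Fin q) ℝ) (Md : Matrix (Fin q) (Fin p) ℝ) : Prop :=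
  M * Md * M = M ∧ Md * M * Md = Md ∧ (M * Md)ᵀ = M * Md ∧ (Md * M)ᵀ = Md * M

/-- If every vector annihilated by `M` is annihilated by `N`, then `N` annihilates every matrix
annihilated by `M` on the left. -/
lemma mul_eq_zero_of_ker_le {p q r s : Type*} [Fintype q] [Fintype s] [DecidableEq s]
    {M : Matrix p q ℝ} {N : Matrix r q ℝ}
    (h : LinearMap.ker M.mulVecLin ≤ LinearMap.ker N.mulVecLin)
    {Z : Matrix q s ℝ} (hZ : M * Z = 0) : N * Z = 0 := by
  refine ext_of_mulVec_single fun i => ?_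
  have hi : Z *ᵥ Pi.single i 1 ∈ LinearMap.ker M.mulVecLin := by
    simp only [LinearMap.mem_ker, mulVecLin_apply, mulVec_mulVec, hZ, zero_mulVec]
  simpa only [LinearMap.mem_ker, mulVecLin_apply, mulVec_mulVec, zero_mulVec] using h hi

/-- The lower-right block of a positive semidefinite block matrix has its kernel contained in that
of the upper-right block. -/
lemma ker_le_ker_of_posSemidef_fromBlocks {p q : Type*} [Fintype p] [Fintype q]
    {Q : Matrix p p ℝ} {S : Matrix p q ℝ} {R : Matrix q q ℝ}
    (h : (fromBlocks Q S Sᵀ R).PosSemidef) :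
    LinearMap.ker R.mulVecLin ≤ LinearMap.ker S.mulVecLin := by
  intro w hw
  rw [LinearMap.mem_ker, mulVecLin_apply] at hw ⊢
  have hM : fromBlocks Q S Sᵀ R *ᵥ Sum.elim 0 w = Sum.elim (S *ᵥ w) 0 := by
    simp [fromBlocks_mulVec, hw]
  have h0 := (h.dotProduct_mulVec_zero_iff (Sum.elim 0 w)).1 (by
    rw [hM]
    simp [dotProduct, Fintype.sum_sum_type])
  rw [hM] at h0
  funext i
  exact congrFun h0 (Sum.inl i)

/-- A solution `X` of the constrained generalized Riccati equation agrees with `Q - S R† Sᵀ` on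
the kernel of `A - B R† Sᵀ`. -/
lemma riccati_mul_eq_of_mul_eq_zero {n m : ℕ} {κ : Type*}
    {A : Matrix (Fin n) (Fin n) ℝ} {B : Matrix (Fin n) (Fin m) ℝ}
    {Q : Matrix (Fin n) (Fin n) ℝ} {S : Matrix (Fin n) (Fin m) ℝ}
    {R : Matrix (Fin m) (Fin m) ℝ} (hR : Rᵀ = R)
    (hPi : (fromBlocks Q S Sᵀ R).PosSemidef)
    {Rd : Matrix (Fin m) (Fin m) ℝ} (hRd : IsMP R Rd)
    {X : Matrix (Fin n) (Fin n) ℝ} (hX : Xᵀ = X)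
    {RXd : Matrix (Fin m) (Fin m) ℝ} (hRXd : IsMP (R + Bᵀ * X * B) RXd)
    (heq : X = Aᵀ * X * A - (Aᵀ * X * B + S) * RXd * (Aᵀ * X * B + S)ᵀ + Q)
    (hker : LinearMap.ker (R + Bᵀ * X * B).mulVecLin ≤
      LinearMap.ker (Aᵀ * X * B + S).mulVecLin)
    {W : Matrix (Fin n) κ ℝ} (hW : (A - B * Rd * Sᵀ) * W = 0) :
    X * W = (Q - S * Rd * Sᵀ) * W := by
  obtain ⟨hR1, -, hR3, -⟩ := hRd
  have hSt : R * Rd * Sᵀ = Sᵀ := by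
    have hZ : R * (1 - R * Rd) = 0 := by
      have h := congrArg transpose hR1
      rw [transpose_mul, hR3, hR] at h
      rw [Matrix.mul_sub, h, Matrix.mul_one, sub_self]
    have h := mul_eq_zero_of_ker_le (ker_le_ker_of_posSemidef_fromBlocks hPi) hZ
    rw [Matrix.mul_sub, Matrix.mul_one, sub_eq_zero] at h
    have h' := congrArg transpose h
    rw [transpose_mul, hR3] at h'
    exact h'.symm
  have hSX : (Aᵀ * X * B + S) * RXd * (R + Bᵀ * X * B) = Aᵀ * X * B + S := by
    have hZ : (R + Bᵀ * X * B) * (1 - RXd * (R + Bᵀ * X * B)) = 0 := by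
      rw [Matrix.mul_sub, Matrix.mul_one, ← Matrix.mul_assoc, hRXd.1, sub_self]
    have h := mul_eq_zero_of_ker_le hker hZ
    rw [Matrix.mul_sub, Matrix.mul_one, sub_eq_zero, ← Matrix.mul_assoc] at h
    exact h.symm
  have hAW : A * W = B * (Rd * Sᵀ * W) := by
    rw [Matrix.sub_mul, sub_eq_zero] at hW
    simpa only [Matrix.mul_assoc] using hW
  have hSXW : (Aᵀ * X * B + S)ᵀ * W = (R + Bᵀ * X * B) * (Rd * Sᵀ * W) := by
    have hRW : R * (Rd * Sᵀ * W) = Sᵀ * W := by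
      rw [← Matrix.mul_assoc, ← Matrix.mul_assoc, hSt]
    rw [transpose_add, transpose_mul, transpose_mul, transpose_transpose, hX, Matrix.add_mul,
      Matrix.add_mul, hRW, ← Matrix.mul_assoc Bᵀ, Matrix.mul_assoc _ A, hAW,
      ← Matrix.mul_assoc _ B, add_comm]
  calc X * W
      = Aᵀ * X * (A * W)
          - (Aᵀ * X * B + S) * RXd * ((Aᵀ * X * B + S)ᵀ * W) + Q * W := by
        conv_lhs => rw [heq]
        rw [Matrix.add_mul, Matrix.sub_mul, Matrix.mul_assoc _ A,
          Matrix.mul_assoc ((Aᵀ * X * B + S) * RXd)]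
    _ = (Q - S * Rd * Sᵀ) * W := by
        rw [hSXW, hAW, ← Matrix.mul_assoc _ (R + Bᵀ * X * B), hSX, Matrix.add_mul,
          Matrix.sub_mul]
        simp only [Matrix.mul_assoc]
        abel

/-- For a symmetric solution `X` of CGDARE(Σ), writing
`X_U = Uᵀ X U` in blocks, the off-diagonal and lower-right blocks of `X_U`
coincide with those of `Q_U = Uᵀ Q₀ U`. -/
theorem stmt9 {n m ν : ℕ} (hn : 0 < n) (hm : 0 < m)
    (A : Matrix (Fin n) (Fin n) ℝ) (B : Matrix (Fin n) (Fin m) ℝ)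
    (Q : Matrix (Fin n) (Fin n) ℝ) (S : Matrix (Fin n) (Fin m) ℝ)
    (R : Matrix (Fin m) (Fin m) ℝ)
    (hQ : Qᵀ = Q) (hR : Rᵀ = R)
    (hPi : (fromBlocks Q S Sᵀ R).PosSemidef)
    (Rd : Matrix (Fin m) (Fin m) ℝ) (hRd : IsMP R Rd)
    (A0 Q0 : Matrix (Fin n) (Fin n) ℝ)
    (hA0 : A0 = A - B * Rd * Sᵀ) (hQ0 : Q0 = Q - S * Rd * Sᵀ)
    (hnu : ν = Module.finrank ℝ (LinearMap.ker A0.mulVecLin))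
    (U : Matrix (Fin n) (Fin (n - ν) ⊕ Fin ν) ℝ)
    (hUl : Uᵀ * U = 1) (hUr : U * Uᵀ = 1)
    (hUspan : LinearMap.range (U.submatrix id Sum.inr).mulVecLin =
      LinearMap.ker A0.mulVecLin)
    (X : Matrix (Fin n) (Fin n) ℝ) (hX : Xᵀ = X)
    (RXd : Matrix (Fin m) (Fin m) ℝ) (hRXd : IsMP (R + Bᵀ * X * B) RXd)
    (heq : X = Aᵀ * X * A - (Aᵀ * X * B + S) * RXd * (Aᵀ * X * B + S)ᵀ + Q)
    (hker : LinearMap.ker (R + Bᵀ * X * B).mulVecLin ≤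
      LinearMap.ker (Aᵀ * X * B + S).mulVecLin) :
    (Uᵀ * X * U).toBlocks₁₂ = (Uᵀ * Q0 * U).toBlocks₁₂ ∧
    (Uᵀ * X * U).toBlocks₂₂ = (Uᵀ * Q0 * U).toBlocks₂₂ := by
  have hW : (A - B * Rd * Sᵀ) * U.submatrix id Sum.inr = 0 := by
    refine ext_of_mulVec_single fun i => ?_
    have hi : U.submatrix id Sum.inr *ᵥ Pi.single i 1 ∈ LinearMap.ker A0.mulVecLin :=
      hUspan ▸ LinearMap.mem_range_self (U.submatrix id Sum.inr).mulVecLin (Pi.single i 1)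
    rw [LinearMap.mem_ker, mulVecLin_apply, mulVec_mulVec, hA0] at hi
    rw [hi, zero_mulVec]
  have hXW := riccati_mul_eq_of_mul_eq_zero hR hPi hRd hX hRXd heq hker hW
  rw [← hQ0] at hXW
  have key : ∀ i j, (Uᵀ * X * U) i (Sum.inr j) = (Uᵀ * Q0 * U) i (Sum.inr j) := fun i j => by
    rw [Matrix.mul_assoc, Matrix.mul_assoc]
    exact congrFun (congrFun (congrArg (Uᵀ * ·) hXW) i) j
  exact ⟨ext fun i j => key (Sum.inl i) j, ext fun i j => key (Sum.inr i) j⟩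
end

section
/- Let X be a symmetric solution of CGDARE(Σ), let X₁₁ be the leading (n−ν)×(n−ν) block of Uᵀ X U, and let Δ₁ = X₁₁ − Q₁₁ be the associated solution of the reduced equation CGDARE(Σ₁). Define the closed-loop matrices A_X = A − B R_X† S_Xᵀ and A_{Δ₁} = A₁ − B₁ (R₁ + B₁ᵀ Δ₁ B₁)† (B₁ᵀ Δ₁ A₁ + S₁ᵀ). Then Uᵀ A_X U has the block form [[A_{Δ₁}, 0], [L, 0_{ν×ν}]] for some L ∈ ℝ^{ν×(n−ν)}; that is, the leading (n−ν)×(n−ν) block of Uᵀ A_X U equals A_{Δ₁} and the last ν columns of Uᵀ A_X U are zero. -/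
open Matrix

section PenroseInverse

variable {p q : ℕ} {M : Matrix (Fin p) (Fin q) ℝ} {N N' : Matrix (Fin q) (Fin p) ℝ}

lemma IsMP.unique (h : IsMP M N) (h' : IsMP M N') : N = N' := by
  obtain ⟨h1, h2, h3, h4⟩ := h
  obtain ⟨k1, k2, k3, k4⟩ := h'
  have hl : M * N = M * N' := by
    calc M * N = (M * N)ᵀ := h3.symm
      _ = (M * N' * (M * N))ᵀ := by rw [← Matrix.mul_assoc, k1]
      _ = M * N * (M * N') := by rw [transpose_mul, h3, k3]
      _ = M * N' := by rw [← Matrix.mul_assoc, h1]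
  have hr : N * M = N' * M := by
    calc N * M = (N * M)ᵀ := h4.symm
      _ = (N * M * (N' * M))ᵀ := by
        rw [show N * M * (N' * M) = N * (M * N' * M) by simp only [Matrix.mul_assoc], k1]
      _ = N' * M * (N * M) := by rw [transpose_mul, h4, k4]
      _ = N' * (M * N * M) := by simp only [Matrix.mul_assoc]
      _ = N' * M := by rw [h1]
  calc N = N * M * N := h2.symm
    _ = N' * (M * N) := by rw [hr, Matrix.mul_assoc]
    _ = N' := by rw [hl, ← Matrix.mul_assoc, k2]

lemma IsMP.transpose (h : IsMP M N) : IsMP Mᵀ Nᵀ := by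
  obtain ⟨h1, h2, h3, h4⟩ := h
  refine ⟨?_, ?_, ?_, ?_⟩
  · rw [Matrix.mul_assoc, ← transpose_mul, ← transpose_mul, h1]
  · rw [Matrix.mul_assoc, ← transpose_mul, ← transpose_mul, h2]
  · rw [← transpose_mul, h4, h4]
  · rw [← transpose_mul, h3, h3]

lemma IsMP.transpose_eq_of_isSymm {M N : Matrix (Fin p) (Fin p) ℝ} (h : IsMP M N)
    (hM : Mᵀ = M) : Nᵀ = N := by
  have ht := h.transpose
  rw [hM] at ht
  exact ht.unique h

lemma IsMP.mul_mul_eq_of_ker_le {r : ℕ} {T : Matrix (Fin r) (Fin q) ℝ} (h : IsMP M N)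
    (hker : ∀ v, M *ᵥ v = 0 → T *ᵥ v = 0) : T * (N * M) = T := by
  refine Matrix.toLin'.injective (LinearMap.ext fun v => ?_)
  have hv : M *ᵥ (v - (N * M) *ᵥ v) = 0 := by
    rw [mulVec_sub, mulVec_mulVec, ← Matrix.mul_assoc, h.1, sub_self]
  have := hker _ hv
  rw [mulVec_sub, mulVec_mulVec, sub_eq_zero] at this
  simpa using this.symm

end PenroseInverse

section PopovMatrix

variable {n m : ℕ} {A Q X : Matrix (Fin n) (Fin n) ℝ} {B S : Matrix (Fin n) (Fin m) ℝ}
  {R : Matrix (Fin m) (Fin m) ℝ}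

lemma popov_quadratic_nonneg (hPi : (fromBlocks Q S Sᵀ R).PosSemidef)
    (x : Fin n → ℝ) (u : Fin m → ℝ) :
    0 ≤ x ⬝ᵥ (Q *ᵥ x + S *ᵥ u) + u ⬝ᵥ (Sᵀ *ᵥ x + R *ᵥ u) := by
  simpa [fromBlocks_mulVec] using hPi.dotProduct_mulVec_nonneg (Sum.elim x u)

lemma popov_mulVec_eq_zero (hPi : (fromBlocks Q S Sᵀ R).PosSemidef)
    {v : Fin m → ℝ} (hv : v ⬝ᵥ (R *ᵥ v) ≤ 0) : R *ᵥ v = 0 ∧ S *ᵥ v = 0 := by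
  have h0 := popov_quadratic_nonneg hPi 0 v
  simp only [mulVec_zero, zero_dotProduct, zero_add] at h0
  have := (hPi.dotProduct_mulVec_zero_iff (Sum.elim 0 v)).1 (by
    simpa [fromBlocks_mulVec] using le_antisymm hv h0)
  simp only [fromBlocks_mulVec, Sum.elim_comp_inl, Sum.elim_comp_inr, mulVec_zero,
    zero_add] at this
  exact ⟨funext fun i => congrFun this (Sum.inr i), funext fun i => congrFun this (Sum.inl i)⟩

/-- One step of the system under the optimal feedback, up to a perturbation `w` of the input
in the kernel of `R_X`, does not increase the storage function defined by `X`. -/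
lemma storage_step_le (hPi : (fromBlocks Q S Sᵀ R).PosSemidef) (hX : Xᵀ = X)
    {RXd : Matrix (Fin m) (Fin m) ℝ}
    (heq : X = Aᵀ * X * A - (Aᵀ * X * B + S) * RXd * (Aᵀ * X * B + S)ᵀ + Q)
    (hS : (R + Bᵀ * X * B) * (RXd * (Aᵀ * X * B + S)ᵀ) = (Aᵀ * X * B + S)ᵀ)
    {w : Fin m → ℝ} (hRw : (R + Bᵀ * X * B) *ᵥ w = 0) (hSw : (Aᵀ * X * B + S) *ᵥ w = 0)
    {x x' : Fin n → ℝ}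
    (hx' : x' = (A - B * RXd * (Aᵀ * X * B + S)ᵀ) *ᵥ x + B *ᵥ w) :
    x' ⬝ᵥ (X *ᵥ x') ≤ x ⬝ᵥ (X *ᵥ x) := by
  obtain ⟨K, hK⟩ : ∃ K, K = RXd * (Aᵀ * X * B + S)ᵀ := ⟨_, rfl⟩
  obtain ⟨u, hu⟩ : ∃ u, u = w - K *ᵥ x := ⟨_, rfl⟩
  have hxu : x' = A *ᵥ x + B *ᵥ u := by
    rw [hx', hu, Matrix.mul_assoc, ← hK, sub_mulVec, mulVec_sub, mulVec_mulVec]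
    abel
  rw [Matrix.mul_assoc _ RXd, ← hK] at heq
  rw [← hK] at hS
  have h1 : X *ᵥ x = Aᵀ *ᵥ (X *ᵥ x') + (Q *ᵥ x + S *ᵥ u) := by
    have hSu : (Aᵀ * X * B + S) *ᵥ u = -(((Aᵀ * X * B + S) * K) *ᵥ x) := by
      rw [hu, mulVec_sub, hSw, mulVec_mulVec, zero_sub]
    have : X *ᵥ x = (Aᵀ * X * A) *ᵥ x + (Aᵀ * X * B + S) *ᵥ u + Q *ᵥ x := by
      rw [hSu, ← sub_eq_add_neg, ← sub_mulVec, ← add_mulVec, ← heq]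
    rw [this, hxu]
    simp only [mulVec_add, add_mulVec, mulVec_mulVec, Matrix.mul_assoc]
    abel
  have h2 : Bᵀ *ᵥ (X *ᵥ x') + (Sᵀ *ᵥ x + R *ᵥ u) = 0 := by
    have hRu : (R + Bᵀ * X * B) *ᵥ u + (Aᵀ * X * B + S)ᵀ *ᵥ x = 0 := by
      rw [hu, mulVec_sub, hRw, mulVec_mulVec, hS, zero_sub, neg_add_cancel]
    rw [← hRu, hxu]
    simp only [mulVec_add, add_mulVec, mulVec_mulVec, Matrix.mul_assoc, transpose_add,
      transpose_mul, transpose_transpose, hX]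
    abel
  have e1 : x ⬝ᵥ (Aᵀ *ᵥ (X *ᵥ x')) = (A *ᵥ x) ⬝ᵥ (X *ᵥ x') := by
    rw [dotProduct_mulVec, vecMul_transpose]
  have e2 : u ⬝ᵥ (Bᵀ *ᵥ (X *ᵥ x')) = (B *ᵥ u) ⬝ᵥ (X *ᵥ x') := by
    rw [dotProduct_mulVec, vecMul_transpose]
  have e3 : x' ⬝ᵥ (X *ᵥ x') = (A *ᵥ x) ⬝ᵥ (X *ᵥ x') + (B *ᵥ u) ⬝ᵥ (X *ᵥ x') := by
    rw [← add_dotProduct, ← hxu]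
  have h3 := congrArg (u ⬝ᵥ ·) h2
  simp only [dotProduct_add u, dotProduct_zero] at h3
  have h4 := congrArg (x ⬝ᵥ ·) h1
  simp only [dotProduct_add x] at h4
  have h5 := popov_quadratic_nonneg hPi x u
  simp only [dotProduct_add] at h5
  linarith

/-- The kernel of `R_X` is contained in the kernel of `R`. The trajectory that evaluates the
characteristic polynomial of the closed-loop matrix by Horner's scheme starts and ends at `0`. -/
lemma mulVec_eq_zero_of_riccati (hPi : (fromBlocks Q S Sᵀ R).PosSemidef) (hX : Xᵀ = X)
    {RXd : Matrix (Fin m) (Fin m) ℝ}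
    (heq : X = Aᵀ * X * A - (Aᵀ * X * B + S) * RXd * (Aᵀ * X * B + S)ᵀ + Q)
    (hS : (R + Bᵀ * X * B) * (RXd * (Aᵀ * X * B + S)ᵀ) = (Aᵀ * X * B + S)ᵀ)
    {v : Fin m → ℝ} (hRv : (R + Bᵀ * X * B) *ᵥ v = 0) (hSv : (Aᵀ * X * B + S) *ᵥ v = 0) :
    R *ᵥ v = 0 := by
  obtain ⟨F, hF⟩ : ∃ F, F = A - B * RXd * (Aᵀ * X * B + S)ᵀ := ⟨_, rfl⟩
  have key : ∀ (d : ℕ) (p : Polynomial ℝ), p.Monic → p.natDegree = d →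
      (Polynomial.aeval F p *ᵥ (B *ᵥ v)) ⬝ᵥ (X *ᵥ (Polynomial.aeval F p *ᵥ (B *ᵥ v)))
        ≤ -(v ⬝ᵥ (R *ᵥ v)) := by
    intro d
    induction d with
    | zero =>
      intro p hp hd
      rw [hp.natDegree_eq_zero.1 hd, map_one, one_mulVec]
      have h := congrArg (v ⬝ᵥ ·) hRv
      simp only [add_mulVec, dotProduct_add, dotProduct_zero] at h
      rw [← mulVec_mulVec, ← mulVec_mulVec, dotProduct_mulVec v Bᵀ, vecMul_transpose] at h
      linarith
    | succ d ih =>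
      intro p hp hd
      have hd' : p.divX.natDegree = d := by
        rw [Polynomial.natDegree_divX_eq_natDegree_tsub_one, hd, Nat.add_sub_cancel]
      have hp' : p.divX.Monic := by
        rw [Polynomial.Monic, Polynomial.leadingCoeff, hd', Polynomial.coeff_divX, ← hd]
        exact hp
      refine le_trans (storage_step_le hPi hX heq hS (w := p.coeff 0 • v) ?_ ?_ ?_)
        (ih p.divX hp' hd')
      · rw [mulVec_smul, hRv, smul_zero]
      · rw [mulVec_smul, hSv, smul_zero]
      · rw [← hF]
        conv_lhs => rw [← Polynomial.X_mul_divX_add p]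
        rw [map_add, map_mul, Polynomial.aeval_X, Polynomial.aeval_C, add_mulVec,
          ← mulVec_mulVec, Algebra.algebraMap_eq_smul_one, smul_mulVec, one_mulVec, mulVec_smul]
  have h := key _ F.charpoly F.charpoly_monic rfl
  rw [aeval_self_charpoly, zero_mulVec, zero_dotProduct] at h
  exact (popov_mulVec_eq_zero hPi (by linarith)).1

end PopovMatrix

lemma transpose_mul_fromBlocks_zero_mul {ι κ α β : Type*} [Fintype ι] [Fintype κ]
    (D : Matrix ι ι ℝ) (M : Matrix (ι ⊕ κ) α ℝ) (N : Matrix (ι ⊕ κ) β ℝ) :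
    Mᵀ * (fromBlocks D 0 0 0 : Matrix (ι ⊕ κ) (ι ⊕ κ) ℝ) * N =
      (M.submatrix Sum.inl id)ᵀ * D * N.submatrix Sum.inl id := by
  ext i j
  simp [mul_apply, Fintype.sum_sum_type]

/-- For a symmetric solution `X` of CGDARE(Σ) with associated
reduced solution `Δ₁`, the closed-loop matrix `A_X = A − B R_X† S_Xᵀ` satisfies
`Uᵀ A_X U = [[A_{Δ₁}, 0], [L, 0]]`: its leading block is
`A_{Δ₁} = A₁ − B₁ (R₁ + B₁ᵀ Δ₁ B₁)† (B₁ᵀ Δ₁ A₁ + S₁ᵀ)` and its last `ν` columns vanish. -/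
theorem stmt13 {n m ν : ℕ} (hn : 0 < n) (hm : 0 < m)
    (A : Matrix (Fin n) (Fin n) ℝ) (B : Matrix (Fin n) (Fin m) ℝ)
    (Q : Matrix (Fin n) (Fin n) ℝ) (S : Matrix (Fin n) (Fin m) ℝ)
    (R : Matrix (Fin m) (Fin m) ℝ)
    (hQ : Qᵀ = Q) (hR : Rᵀ = R)
    (hPi : (fromBlocks Q S Sᵀ R).PosSemidef)
    (Rd : Matrix (Fin m) (Fin m) ℝ) (hRd : IsMP R Rd)
    (A0 Q0 : Matrix (Fin n) (Fin n) ℝ)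
    (hA0 : A0 = A - B * Rd * Sᵀ) (hQ0 : Q0 = Q - S * Rd * Sᵀ)
    (hnu : ν = Module.finrank ℝ (LinearMap.ker A0.mulVecLin))
    (U : Matrix (Fin n) (Fin (n - ν) ⊕ Fin ν) ℝ)
    (hUl : Uᵀ * U = 1) (hUr : U * Uᵀ = 1)
    (hUspan : LinearMap.range (U.submatrix id Sum.inr).mulVecLin =
      LinearMap.ker A0.mulVecLin)
    (Atil : Matrix (Fin (n - ν) ⊕ Fin ν) (Fin (n - ν)) ℝ)
    (hAtil : Atil = Uᵀ * A0 * U.submatrix id Sum.inl)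
    (BU : Matrix (Fin (n - ν) ⊕ Fin ν) (Fin m) ℝ) (hBU : BU = Uᵀ * B)
    (QU : Matrix (Fin (n - ν) ⊕ Fin ν) (Fin (n - ν) ⊕ Fin ν) ℝ) (hQU : QU = Uᵀ * Q0 * U)
    (Q1 : Matrix (Fin (n - ν)) (Fin (n - ν)) ℝ) (hQ1 : Q1 = Atilᵀ * QU * Atil)
    (S1 : Matrix (Fin (n - ν)) (Fin m) ℝ) (hS1 : S1 = Atilᵀ * QU * BU)
    (R1 : Matrix (Fin m) (Fin m) ℝ) (hR1 : R1 = R + BUᵀ * QU * BU)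
    (A1 : Matrix (Fin (n - ν)) (Fin (n - ν)) ℝ) (hA1 : A1 = Atil.submatrix Sum.inl id)
    (B1 : Matrix (Fin (n - ν)) (Fin m) ℝ) (hB1 : B1 = BU.submatrix Sum.inl id)
    (X : Matrix (Fin n) (Fin n) ℝ) (hX : Xᵀ = X)
    (RXd : Matrix (Fin m) (Fin m) ℝ) (hRXd : IsMP (R + Bᵀ * X * B) RXd)
    (heq : X = Aᵀ * X * A - (Aᵀ * X * B + S) * RXd * (Aᵀ * X * B + S)ᵀ + Q)
    (hker : LinearMap.ker (R + Bᵀ * X * B).mulVecLin ≤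
      LinearMap.ker (Aᵀ * X * B + S).mulVecLin)
    (D1 : Matrix (Fin (n - ν)) (Fin (n - ν)) ℝ)
    (hD1 : D1 = (Uᵀ * X * U).toBlocks₁₁ - QU.toBlocks₁₁)
    (RD1d : Matrix (Fin m) (Fin m) ℝ) (hRD1d : IsMP (R1 + B1ᵀ * D1 * B1) RD1d)
    (AX : Matrix (Fin n) (Fin n) ℝ) (hAX : AX = A - B * RXd * (Aᵀ * X * B + S)ᵀ)
    (AD1 : Matrix (Fin (n - ν)) (Fin (n - ν)) ℝ)
    (hAD1 : AD1 = A1 - B1 * RD1d * (B1ᵀ * D1 * A1 + S1ᵀ)) :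
    (Uᵀ * AX * U).toBlocks₁₁ = AD1 ∧
    (Uᵀ * AX * U).toBlocks₁₂ = 0 ∧
    (Uᵀ * AX * U).toBlocks₂₂ = 0 := by
  have hRXs : (R + Bᵀ * X * B)ᵀ = R + Bᵀ * X * B := by
    simp only [transpose_add, transpose_mul, transpose_transpose, hR, hX, Matrix.mul_assoc]
  have hRds : Rdᵀ = Rd := hRd.transpose_eq_of_isSymm hR
  have hRXds : RXdᵀ = RXd := hRXd.transpose_eq_of_isSymm hRXs
  have hRXcomm : (RXd * (R + Bᵀ * X * B))ᵀ = (R + Bᵀ * X * B) * RXd := by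
    rw [transpose_mul, hRXds, hRXs]
  have hSXr : (Aᵀ * X * B + S) * (RXd * (R + Bᵀ * X * B)) = Aᵀ * X * B + S :=
    hRXd.mul_mul_eq_of_ker_le fun v hv => hker hv
  have hSX : (R + Bᵀ * X * B) * (RXd * (Aᵀ * X * B + S)ᵀ) = (Aᵀ * X * B + S)ᵀ := by
    have := congrArg Matrix.transpose hSXr
    rwa [transpose_mul, hRXcomm, Matrix.mul_assoc] at this
  have hRN : R * (RXd * (R + Bᵀ * X * B)) = R :=
    hRXd.mul_mul_eq_of_ker_le fun v hv =>
      mulVec_eq_zero_of_riccati hPi hX heq hSX hv (hker hv)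
  have hRdN : RXd * ((R + Bᵀ * X * B) * Rd) = Rd := by
    have h1 : Rd = R * (Rd * Rd) := by
      have h := congrArg Matrix.transpose hRd.2.1
      have h' := hRd.2.2.2
      rw [transpose_mul, hR, hRds] at h'
      calc Rd = Rd * R * Rd := hRd.2.1.symm
        _ = R * (Rd * Rd) := by rw [← h', Matrix.mul_assoc]
    have h2 : RXd * ((R + Bᵀ * X * B) * R) = R := by
      have h := congrArg Matrix.transpose hRN
      have h' := hRXd.2.2.2
      rw [transpose_mul, h', hR, Matrix.mul_assoc] at h
      exact h
    calc RXd * ((R + Bᵀ * X * B) * Rd)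
        = RXd * ((R + Bᵀ * X * B) * (R * (Rd * Rd))) := by rw [← h1]
      _ = RXd * ((R + Bᵀ * X * B) * R) * (Rd * Rd) := by simp only [Matrix.mul_assoc]
      _ = Rd := by rw [h2, ← h1]
  have hSR : R * (Rd * Sᵀ) = Sᵀ := by
    have h : S * (Rd * R) = S := hRd.mul_mul_eq_of_ker_le fun v hv =>
      (popov_mulVec_eq_zero hPi (by rw [hv, dotProduct_zero])).2
    have h' := congrArg Matrix.transpose h
    rwa [transpose_mul, transpose_mul, hR, hRds, Matrix.mul_assoc] at h'
  have hA : A = A0 + B * (Rd * Sᵀ) := by rw [hA0, Matrix.mul_assoc, sub_add_cancel]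
  have hSXt : (Aᵀ * X * B + S)ᵀ = Bᵀ * X * A0 + (R + Bᵀ * X * B) * (Rd * Sᵀ) := by
    simp only [transpose_add, transpose_mul, transpose_transpose, hX, Matrix.add_mul,
      hSR]
    rw [hA]
    simp only [Matrix.mul_add, Matrix.mul_assoc]
    abel
  have hK : RXd * (Aᵀ * X * B + S)ᵀ = RXd * (Bᵀ * X * A0) + Rd * Sᵀ := by
    rw [hSXt, Matrix.mul_add]
    congr 1
    rw [← Matrix.mul_assoc _ Rd, ← Matrix.mul_assoc RXd, hRdN]
  have hAX0 : AX = A0 - B * (RXd * (Bᵀ * X * A0)) := by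
    rw [hAX, Matrix.mul_assoc, hK, hA, Matrix.mul_add]
    abel
  have hA0U : A0 * U.submatrix id Sum.inr = 0 := by
    refine Matrix.toLin'.injective (LinearMap.ext fun w => ?_)
    have : (U.submatrix id Sum.inr) *ᵥ w ∈ LinearMap.ker A0.mulVecLin :=
      hUspan ▸ ⟨w, rfl⟩
    simpa using this
  have hAXU : AX * U.submatrix id Sum.inr = 0 := by
    simp only [hAX0, Matrix.sub_mul, Matrix.mul_assoc, hA0U, Matrix.mul_zero, sub_zero]
  have hXeq : X - Q0 = (Aᵀ * X * B + S) * RXd * (-(Bᵀ * X * A0)) + Aᵀ * X * A0 := by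
    have e : X = Aᵀ * X * A - (Aᵀ * X * B + S) * (RXd * (Aᵀ * X * B + S)ᵀ) + Q := by
      rw [← Matrix.mul_assoc]; exact heq
    rw [hK] at e
    have hAr : Aᵀ * X * A = Aᵀ * X * A0 + Aᵀ * X * (B * (Rd * Sᵀ)) := by
      rw [← Matrix.mul_add, ← hA]
    rw [hAr] at e
    rw [sub_eq_iff_eq_add]
    refine e.trans ?_
    rw [hQ0]
    simp only [Matrix.mul_add, Matrix.add_mul, Matrix.mul_assoc, Matrix.mul_neg]
    abel
  have hQ0s : Q0ᵀ = Q0 := by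
    rw [hQ0]
    simp only [transpose_sub, transpose_mul, transpose_transpose, hQ, hRds, Matrix.mul_assoc]
  have hXU : (X - Q0) * U.submatrix id Sum.inr = 0 := by
    simp only [hXeq, Matrix.add_mul, Matrix.mul_assoc, Matrix.neg_mul, hA0U, Matrix.mul_zero,
      neg_zero, add_zero]
  have hUXU : (Uᵀ * (X - Q0) * U).submatrix id Sum.inr = 0 := by
    have : (Uᵀ * (X - Q0) * U).submatrix id Sum.inr
        = Uᵀ * (X - Q0) * U.submatrix id Sum.inr := rfl
    rw [this, Matrix.mul_assoc, hXU, Matrix.mul_zero]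
  have hUXUs : (Uᵀ * (X - Q0) * U)ᵀ = Uᵀ * (X - Q0) * U := by
    simp only [transpose_mul, transpose_sub, transpose_transpose, hX, hQ0s, Matrix.mul_assoc]
  have hdiff : Uᵀ * X * U = QU + fromBlocks D1 0 0 0 := by
    have hsub : Uᵀ * (X - Q0) * U = Uᵀ * X * U - QU := by
      rw [hQU, Matrix.mul_sub, Matrix.sub_mul]
    rw [← sub_eq_iff_eq_add', ← hsub]
    ext i j
    rcases j with j | j
    · rcases i with i | i
      · rw [hsub, hD1]; rfl
      · rw [← hUXUs]
        exact congrFun (congrFun hUXU (Sum.inl j)) i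
    · have := congrFun (congrFun hUXU i) j
      rcases i with i | i <;> exact this
  have hXr : X = U * (Uᵀ * X * U) * Uᵀ := by
    calc X = (U * Uᵀ) * X * (U * Uᵀ) := by rw [hUr, Matrix.one_mul, Matrix.mul_one]
      _ = _ := by simp only [Matrix.mul_assoc]
  have hQUs : QUᵀ = QU := by
    rw [hQU]
    simp only [transpose_mul, transpose_transpose, hQ0s, Matrix.mul_assoc]
  have hBX {l : ℕ} (N : Matrix (Fin n) (Fin l) ℝ) : Bᵀ * X * N =
      BUᵀ * QU * (Uᵀ * N) + B1ᵀ * D1 * (Uᵀ * N).submatrix Sum.inl id := by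
    have : Bᵀ * X * N = BUᵀ * (Uᵀ * X * U) * (Uᵀ * N) := by
      rw [hBU, transpose_mul, transpose_transpose]
      conv_lhs => rw [hXr]
      simp only [Matrix.mul_assoc]
    rw [this, hdiff, Matrix.mul_add, Matrix.add_mul, transpose_mul_fromBlocks_zero_mul, hB1]
  have hRX : R + Bᵀ * X * B = R1 + B1ᵀ * D1 * B1 := by
    rw [hBX, ← hBU, ← hB1, hR1, add_assoc]
  have hRd1 : RD1d = RXd := by
    rw [← hRX] at hRD1d
    exact hRD1d.unique hRXd
  have hgain : Bᵀ * X * (A0 * U.submatrix id Sum.inl) = B1ᵀ * D1 * A1 + S1ᵀ := by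
    rw [hBX, ← Matrix.mul_assoc Uᵀ, ← hAtil, ← hA1, hS1, add_comm]
    simp only [transpose_mul, transpose_transpose, hQUs, Matrix.mul_assoc]
  have hcol : (Uᵀ * AX * U).submatrix id Sum.inr = 0 := by
    have : (Uᵀ * AX * U).submatrix id Sum.inr = Uᵀ * AX * U.submatrix id Sum.inr := rfl
    rw [this, Matrix.mul_assoc, hAXU, Matrix.mul_zero]
  refine ⟨?_, ?_, ?_⟩
  · have h1 : Uᵀ * AX * U.submatrix id Sum.inl
        = Atil - BU * (RXd * (B1ᵀ * D1 * A1 + S1ᵀ)) := by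
      rw [← hgain, hAX0, hAtil, hBU]
      simp only [Matrix.mul_sub, Matrix.sub_mul, Matrix.mul_assoc]
    have h2 : (Uᵀ * AX * U).toBlocks₁₁
        = (Uᵀ * AX * U.submatrix id Sum.inl).submatrix Sum.inl id := rfl
    rw [h2, h1, hAD1, hRd1, ← hgain, hA1, hB1, Matrix.mul_assoc (BU.submatrix Sum.inl id)]
    rfl
  · ext i j
    exact congrFun (congrFun hcol (Sum.inl i)) j
  · ext i j
    exact congrFun (congrFun hcol (Sum.inr i)) j
end

section
/- Let X be a symmetric solution of CGDARE(Σ), write X_V = Vᵀ X V and let X₁₁ be its leading (n−η)×(n−η) block. Then Δ₁ = X₁₁ − Q₁₁ is a symmetric solution of the reduced equation CGDARE(Σ₁): Δ₁ = A₁ᵀ Δ₁ A₁ − (A₁ᵀ Δ₁ B₁ + S₁)(R₁ + B₁ᵀ Δ₁ B₁)†(B₁ᵀ Δ₁ A₁ + S₁ᵀ) + Q₁ and ker(R₁ + B₁ᵀ Δ₁ B₁) ⊆ ker(S₁ + A₁ᵀ Δ₁ B₁). -/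
open Matrix

/-- A matrix `T` annihilated on the kernel of `P` factors through `P`, via any `Pd` with
`P * Pd * P = P`. -/
theorem IsMP.mul_mul_of_ker_le {p q r : ℕ} {P : Matrix (Fin p) (Fin q) ℝ}
    {Pd : Matrix (Fin q) (Fin p) ℝ} (h : IsMP P Pd) {T : Matrix (Fin r) (Fin q) ℝ}
    (hT : LinearMap.ker P.mulVecLin ≤ LinearMap.ker T.mulVecLin) : T * Pd * P = T := by
  refine Matrix.mulVec_injective (funext fun x => ?_)
  have h0 : x - (Pd * P) *ᵥ x ∈ LinearMap.ker P.mulVecLin := by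
    rw [LinearMap.mem_ker, Matrix.mulVecLin_apply, Matrix.mulVec_sub, Matrix.mulVec_mulVec,
      ← Matrix.mul_assoc, h.1, sub_self]
  have h1 := hT h0
  rw [LinearMap.mem_ker, Matrix.mulVecLin_apply, Matrix.mulVec_sub, Matrix.mulVec_mulVec,
    ← Matrix.mul_assoc, sub_eq_zero] at h1
  exact h1.symm

/-- The kernel of the lower right block of a positive semidefinite block matrix is contained in
the kernel of the upper right block. -/
theorem Matrix.PosSemidef.ker_fromBlocks_le {n m : ℕ} {Q : Matrix (Fin n) (Fin n) ℝ}
    {S : Matrix (Fin n) (Fin m) ℝ} {R : Matrix (Fin m) (Fin m) ℝ}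
    (h : (fromBlocks Q S Sᵀ R).PosSemidef) :
    LinearMap.ker R.mulVecLin ≤ LinearMap.ker S.mulVecLin := by
  intro u hu
  rw [LinearMap.mem_ker, Matrix.mulVecLin_apply] at hu ⊢
  have h0 := (h.dotProduct_mulVec_zero_iff (Sum.elim 0 u)).1 (by
    simp [Matrix.fromBlocks_mulVec, hu, dotProduct, Fintype.sum_sum_type])
  funext i
  simpa [Matrix.fromBlocks_mulVec] using congrFun h0 (Sum.inl i)

/-- Solutions of the generalized Riccati equation are invariant under the feedback `L`, where
`R * L = Sᵀ`, that removes the cross term. -/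
theorem riccati_feedback {n m : ℕ} {A0 Q X : Matrix (Fin n) (Fin n) ℝ}
    {B S : Matrix (Fin n) (Fin m) ℝ} {R RXd : Matrix (Fin m) (Fin m) ℝ}
    {L : Matrix (Fin m) (Fin n) ℝ} (hR : Rᵀ = R) (hL : R * L = Sᵀ) (hX : Xᵀ = X)
    (hRXd : IsMP (R + Bᵀ * X * B) RXd)
    (heq : X = (A0 + B * L)ᵀ * X * (A0 + B * L) -
      ((A0 + B * L)ᵀ * X * B + S) * RXd * ((A0 + B * L)ᵀ * X * B + S)ᵀ + Q)
    (hker : LinearMap.ker (R + Bᵀ * X * B).mulVecLin ≤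
      LinearMap.ker ((A0 + B * L)ᵀ * X * B + S).mulVecLin) :
    ∃ H : Matrix (Fin n) (Fin m) ℝ, A0ᵀ * X * B = H * (R + Bᵀ * X * B) ∧
      X = A0ᵀ * X * A0 - H * (R + Bᵀ * X * B) * Hᵀ + (Q - Lᵀ * R * L) := by
  have hS : S = Lᵀ * R := by rw [← transpose_transpose S, ← hL, transpose_mul, hR]
  have hRX : (R + Bᵀ * X * B)ᵀ = R + Bᵀ * X * B := by
    simp [hR, hX, Matrix.mul_assoc]
  have hSX : (A0 + B * L)ᵀ * X * B + S = A0ᵀ * X * B + Lᵀ * (R + Bᵀ * X * B) := by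
    simp only [hS, transpose_add, transpose_mul, Matrix.add_mul, Matrix.mul_add, Matrix.mul_assoc]
    abel
  have hfac := hRXd.mul_mul_of_ker_le hker
  rw [hSX] at heq hfac
  set P := R + Bᵀ * X * B with hP
  have hN : A0ᵀ * X * B = (A0ᵀ * X * B * RXd) * P := by
    have h1 : Lᵀ * P * RXd * P = Lᵀ * P := by
      rw [Matrix.mul_assoc, Matrix.mul_assoc, ← Matrix.mul_assoc P, hRXd.1]
    rw [Matrix.add_mul, Matrix.add_mul, h1] at hfac
    exact (add_right_cancel hfac).symm
  refine ⟨A0ᵀ * X * B * RXd, hN, ?_⟩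
  generalize A0ᵀ * X * B * RXd = H at hN
  have hNt : Bᵀ * X * A0 = P * Hᵀ := by
    have := congrArg transpose hN
    rwa [transpose_mul, transpose_mul, transpose_mul, transpose_transpose, hX, hRX,
      ← Matrix.mul_assoc] at this
  have hquad : (A0ᵀ * X * B + Lᵀ * P) * RXd * (A0ᵀ * X * B + Lᵀ * P)ᵀ =
      (H + Lᵀ) * P * (H + Lᵀ)ᵀ := by
    rw [hN, ← Matrix.add_mul, transpose_mul, hRX, ← Matrix.mul_assoc,
      Matrix.mul_assoc _ P RXd, Matrix.mul_assoc (H + Lᵀ) _ P, hRXd.1]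
  have hlin : (A0 + B * L)ᵀ * X * (A0 + B * L) =
      A0ᵀ * X * A0 + H * P * L + Lᵀ * (P * Hᵀ) + Lᵀ * (P - R) * L := by
    rw [← hN, ← hNt, hP, add_sub_cancel_left]
    simp only [transpose_add, transpose_mul, Matrix.add_mul, Matrix.mul_add, Matrix.mul_assoc]
    abel
  rw [hquad, hlin] at heq
  refine heq.trans ?_
  simp only [transpose_add, transpose_transpose, Matrix.add_mul, Matrix.mul_add, Matrix.mul_sub,
    Matrix.sub_mul, Matrix.mul_assoc]
  abel

/-- If `X` is a symmetric solution of CGDARE(Σ) and `X₁₁` is the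
leading block of `Vᵀ X V`, then `Δ₁ = X₁₁ − Q₁₁` is a symmetric solution of the
reduced equation CGDARE(Σ₁). -/
theorem stmt17 {n m η : ℕ} (hn : 0 < n) (hm : 0 < m)
    (A : Matrix (Fin n) (Fin n) ℝ) (B : Matrix (Fin n) (Fin m) ℝ)
    (Q : Matrix (Fin n) (Fin n) ℝ) (S : Matrix (Fin n) (Fin m) ℝ)
    (R : Matrix (Fin m) (Fin m) ℝ)
    (hQ : Qᵀ = Q) (hR : Rᵀ = R)
    (hPi : (fromBlocks Q S Sᵀ R).PosSemidef)
    (Rd : Matrix (Fin m) (Fin m) ℝ) (hRd : IsMP R Rd)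
    (A0 Q0 : Matrix (Fin n) (Fin n) ℝ)
    (hA0 : A0 = A - B * Rd * Sᵀ) (hQ0 : Q0 = Q - S * Rd * Sᵀ)
    (hA0inv : IsUnit A0)
    (heta : η = Module.finrank ℝ
      (Submodule.map (A0⁻¹ * B).mulVecLin (LinearMap.ker R.mulVecLin)))
    (V : Matrix (Fin n) (Fin (n - η) ⊕ Fin η) ℝ)
    (hVl : Vᵀ * V = 1) (hVr : V * Vᵀ = 1)
    (hVspan : LinearMap.range (V.submatrix id Sum.inr).mulVecLin =
      Submodule.map (A0⁻¹ * B).mulVecLin (LinearMap.ker R.mulVecLin))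
    (AV QV : Matrix (Fin (n - η) ⊕ Fin η) (Fin (n - η) ⊕ Fin η) ℝ)
    (hAV : AV = Vᵀ * A0 * V) (hQV : QV = Vᵀ * Q0 * V)
    (BV : Matrix (Fin (n - η) ⊕ Fin η) (Fin m) ℝ) (hBV : BV = Vᵀ * B)
    (Q1 : Matrix (Fin (n - η)) (Fin (n - η)) ℝ) (hQ1 : Q1 = (AVᵀ * QV * AV).toBlocks₁₁)
    (S1 : Matrix (Fin (n - η)) (Fin m) ℝ) (hS1 : S1 = (AVᵀ * QV * BV).submatrix Sum.inl id)
    (R1 : Matrix (Fin m) (Fin m) ℝ) (hR1 : R1 = R + Bᵀ * Q0 * B)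
    (A1 : Matrix (Fin (n - η)) (Fin (n - η)) ℝ)
    (hA1 : A1 = (V.submatrix id Sum.inl)ᵀ * A0 * V.submatrix id Sum.inl)
    (B1 : Matrix (Fin (n - η)) (Fin m) ℝ) (hB1 : B1 = (V.submatrix id Sum.inl)ᵀ * B)
    (X : Matrix (Fin n) (Fin n) ℝ) (hX : Xᵀ = X)
    (RXd : Matrix (Fin m) (Fin m) ℝ) (hRXd : IsMP (R + Bᵀ * X * B) RXd)
    (heq : X = Aᵀ * X * A - (Aᵀ * X * B + S) * RXd * (Aᵀ * X * B + S)ᵀ + Q)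
    (hker : LinearMap.ker (R + Bᵀ * X * B).mulVecLin ≤
      LinearMap.ker (Aᵀ * X * B + S).mulVecLin)
    (D1 : Matrix (Fin (n - η)) (Fin (n - η)) ℝ)
    (hD1 : D1 = (Vᵀ * X * V).toBlocks₁₁ - QV.toBlocks₁₁)
    (RD1d : Matrix (Fin m) (Fin m) ℝ) (hRD1d : IsMP (R1 + B1ᵀ * D1 * B1) RD1d) :
    D1ᵀ = D1 ∧
    D1 = A1ᵀ * D1 * A1 - (A1ᵀ * D1 * B1 + S1) * RD1d * (B1ᵀ * D1 * A1 + S1ᵀ) + Q1 ∧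
    LinearMap.ker (R1 + B1ᵀ * D1 * B1).mulVecLin ≤
      LinearMap.ker (S1 + A1ᵀ * D1 * B1).mulVecLin := by
  set L := Rd * Sᵀ with hLdef
  have hL : R * L = Sᵀ := by
    have := congrArg transpose (hRd.mul_mul_of_ker_le hPi.ker_fromBlocks_le)
    rw [← this, hLdef, ← this]
    simp only [transpose_mul, hR]
    have hRR : R * (Rd * R) = R := by rw [← Matrix.mul_assoc, hRd.1]
    simp only [← Matrix.mul_assoc, hRd.1]
  have hSL : S = Lᵀ * R := by rw [← transpose_transpose S, ← hL, transpose_mul, hR]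
  have hSRS : S * Rd * Sᵀ = Lᵀ * R * L := by
    rw [Matrix.mul_assoc, ← hLdef, ← hSL]
  have hAL : A = A0 + B * L := by rw [hA0, Matrix.mul_assoc, sub_add_cancel]
  rw [hSRS] at hQ0
  subst hAL
  obtain ⟨H, hN, hXeq⟩ := riccati_feedback hR hL hX hRXd heq hker
  rw [← hQ0] at hXeq
  have hQ0t : Q0ᵀ = Q0 := by
    rw [hQ0]; simp [hQ, hR, Matrix.mul_assoc]
  have hRX : (R + Bᵀ * X * B)ᵀ = R + Bᵀ * X * B := by
    simp [hR, hX, Matrix.mul_assoc]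
  set P := R + Bᵀ * X * B with hP
  have hNt : Bᵀ * X * A0 = P * Hᵀ := by
    have := congrArg transpose hN
    rwa [transpose_mul, transpose_mul, transpose_mul, transpose_transpose, hX, hRX,
      ← Matrix.mul_assoc] at this
  set V1 := V.submatrix id Sum.inl with hV1
  set V2 := V.submatrix id Sum.inr with hV2
  have hVV : V1 * V1ᵀ + V2 * V2ᵀ = 1 := by
    rw [← hVr]
    ext i j
    simp [hV1, hV2, Matrix.mul_apply, Fintype.sum_sum_type]
  have hD1' : D1 = V1ᵀ * (X - Q0) * V1 := by
    rw [hD1, hQV, Matrix.mul_sub, Matrix.sub_mul]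
    rfl
  have hA0i : A0 * A0⁻¹ = 1 := Matrix.mul_nonsing_inv _ ((Matrix.isUnit_iff_isUnit_det _).1 hA0inv)
  have hXV2 : (X - Q0) * V2 = 0 := by
    refine Matrix.mulVec_injective (funext fun y => ?_)
    have hy : V2 *ᵥ y ∈ LinearMap.range V2.mulVecLin := ⟨y, rfl⟩
    rw [hVspan] at hy
    obtain ⟨u, hu, hw⟩ := hy
    rw [SetLike.mem_coe, LinearMap.mem_ker, Matrix.mulVecLin_apply] at hu
    rw [Matrix.mulVecLin_apply] at hw
    have hAw : A0 *ᵥ (V2 *ᵥ y) = B *ᵥ u := by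
      rw [← hw, Matrix.mulVec_mulVec, ← Matrix.mul_assoc, hA0i, Matrix.one_mul]
    have hPu : (Bᵀ * X * B) *ᵥ u = P *ᵥ u := by
      rw [hP, Matrix.add_mulVec, hu, zero_add]
    have hXQ : X - Q0 = (A0ᵀ * X - H * (Bᵀ * X)) * A0 := by
      rw [Matrix.sub_mul, Matrix.mul_assoc H, hNt, ← Matrix.mul_assoc H]
      exact sub_eq_of_eq_add hXeq
    rw [← Matrix.mulVec_mulVec, hXQ, ← Matrix.mulVec_mulVec, hAw, Matrix.mulVec_mulVec,
      Matrix.sub_mul, Matrix.sub_mulVec, Matrix.mul_assoc H, ← Matrix.mulVec_mulVec _ H, hPu,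
      Matrix.mulVec_mulVec, ← hN, sub_self, Matrix.zero_mulVec]
  have hXt : (X - Q0)ᵀ = X - Q0 := by rw [transpose_sub, hX, hQ0t]
  have hV2X : V2ᵀ * (X - Q0) = 0 := by
    have := congrArg transpose hXV2
    rwa [transpose_mul, hXt, transpose_zero] at this
  have hDelta : V1 * D1 * V1ᵀ = X - Q0 := by
    have h1 : (X - Q0) * (V1 * V1ᵀ) = X - Q0 := by
      rw [eq_sub_of_add_eq hVV, Matrix.mul_sub, ← Matrix.mul_assoc, hXV2]
      simp
    have h2 : V1 * V1ᵀ * (X - Q0) = X - Q0 := by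
      rw [eq_sub_of_add_eq hVV, Matrix.sub_mul, Matrix.mul_assoc, hV2X]
      simp
    calc V1 * D1 * V1ᵀ = V1 * V1ᵀ * (X - Q0) * (V1 * V1ᵀ) := by
          rw [hD1']; simp only [Matrix.mul_assoc]
      _ = X - Q0 := by rw [h2, h1]
  have hsandwich {k l : ℕ} (C : Matrix (Fin k) (Fin n) ℝ) (E : Matrix (Fin n) (Fin l) ℝ) :
      C * V1 * D1 * (V1ᵀ * E) = C * (X - Q0) * E := by
    rw [← hDelta]; simp only [Matrix.mul_assoc]
  have hBDB : R1 + B1ᵀ * D1 * B1 = P := by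
    rw [hB1, transpose_mul, transpose_transpose, hsandwich, hR1, hP, Matrix.mul_sub,
      Matrix.sub_mul]
    abel
  have hS1' : S1 = V1ᵀ * (A0ᵀ * Q0 * B) := by
    have : AVᵀ * QV * BV = Vᵀ * (A0ᵀ * Q0 * B) := by
      rw [hAV, hQV, hBV]
      calc _ = (Vᵀ * A0ᵀ) * (V * Vᵀ) * Q0 * (V * Vᵀ) * B := by
            simp only [transpose_mul, transpose_transpose, Matrix.mul_assoc]
        _ = _ := by rw [hVr]; simp only [Matrix.mul_one, Matrix.mul_assoc]
    rw [hS1, this]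
    rfl
  have hQ1' : Q1 = V1ᵀ * (A0ᵀ * Q0 * A0) * V1 := by
    have : AVᵀ * QV * AV = Vᵀ * (A0ᵀ * Q0 * A0) * V := by
      rw [hAV, hQV]
      calc _ = (Vᵀ * A0ᵀ) * (V * Vᵀ) * Q0 * (V * Vᵀ) * A0 * V := by
            simp only [transpose_mul, transpose_transpose, Matrix.mul_assoc]
        _ = _ := by rw [hVr]; simp only [Matrix.mul_one, Matrix.mul_assoc]
    rw [hQ1, this]
    rfl
  have hA1t : A1ᵀ = V1ᵀ * A0ᵀ * V1 := by
    rw [hA1]; simp only [transpose_mul, transpose_transpose, Matrix.mul_assoc]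
  have hADB : A1ᵀ * D1 * B1 + S1 = V1ᵀ * H * P := by
    rw [hA1t, hB1, hsandwich, hS1', Matrix.mul_assoc V1ᵀ H, ← hN]
    simp only [Matrix.mul_sub, Matrix.sub_mul, Matrix.mul_assoc, sub_add_cancel]
  have hD1t : D1ᵀ = D1 := by
    rw [hD1']
    simp only [transpose_mul, transpose_transpose, hXt, Matrix.mul_assoc]
  refine ⟨hD1t, ?_, ?_⟩
  · have hADBt : B1ᵀ * D1 * A1 + S1ᵀ = P * (Hᵀ * V1) := by
      have := congrArg transpose hADB
      simpa only [transpose_add, transpose_mul, transpose_transpose, hD1t, hRX,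
        Matrix.mul_assoc] using this
    have hD1Eq : D1 = V1ᵀ * (A0ᵀ * X * A0 - H * P * Hᵀ) * V1 := by
      rw [hD1', sub_eq_of_eq_add hXeq]
    have hADA : A1ᵀ * D1 * A1 = V1ᵀ * A0ᵀ * (X - Q0) * (A0 * V1) := by
      rw [hA1t, hA1, Matrix.mul_assoc V1ᵀ A0 V1, hsandwich]
    have hquad : V1ᵀ * H * P * RD1d * (P * (Hᵀ * V1)) = V1ᵀ * (H * P * Hᵀ) * V1 := by
      rw [hBDB] at hRD1d
      rw [← Matrix.mul_assoc _ P, Matrix.mul_assoc _ P RD1d, Matrix.mul_assoc _ _ P, hRD1d.1]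
      simp only [Matrix.mul_assoc]
    rw [hADB, hADBt, hADA, hquad, hQ1']
    refine hD1Eq.trans ?_
    simp only [Matrix.mul_sub, Matrix.sub_mul, Matrix.mul_assoc]
    abel
  · rw [hBDB, add_comm, hADB]
    intro u hu
    rw [LinearMap.mem_ker, Matrix.mulVecLin_apply] at hu ⊢
    rw [← Matrix.mulVec_mulVec, hu, Matrix.mulVec_zero]
end
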